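/- arXiv:1908.09192 — 5 statements merged into one kernel-verified Lean document; each statement's English description precedes it below -/
import Mathlib

section
/- Let k be a field of characteristic different from 2 and let n ≥ 1. The dimension over k of the vector space V_n = {f : S_n → k | f(σ π σ⁻¹) = sign(σ)·f(π) for all σ, π ∈ S_n} equals the number of partitions of n into pairwise distinct odd parts. -/
/-- The subspace `V_n` of functions `f : S_n → k` satisfying
`f (σ * π * σ⁻¹) = sign σ * f π` for all `σ, π`. -/
def signConjInvariants (k : Type*) [Field k] (n : ℕ) :
    Submodule k (Equiv.Perm (Fin n) → k) where
  carrier := {f | ∀ σ π : Equiv.Perm (Fin n),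
    f (σ * π * σ⁻¹) = ((Equiv.Perm.sign σ : ℤ) : k) * f π}
  add_mem' := by
    intro f g hf hg σ π
    simp only [Pi.add_apply, hf σ π, hg σ π]
    ring
  zero_mem' := by
    intro σ π
    simp
  smul_mem' := by
    intro c f hf σ π
    simp only [Pi.smul_apply, smul_eq_mul, hf σ π]
    ring

open Equiv.Perm in
lemma exists_partition_map {α : Type*} [Fintype α] [DecidableEq α] (n : ℕ)
    (h : Fintype.card α = n) :
    ∃ P : Equiv.Perm α → n.Partition, Function.Surjective P ∧
      (∀ a b, P a = P b ↔ IsConj a b) ∧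
      (∀ g, P g ∈ Nat.Partition.odds n ∩ Nat.Partition.distincts n ↔
        Subgroup.centralizer {g} ≤ alternatingGroup α) := by
  subst h
  refine ⟨fun g => g.partition, ?_, fun a b => partition_eq_of_isConj.symm, ?_⟩
  · intro p
    have key : p.parts = p.parts.filter (2 ≤ ·) +
        Multiset.replicate (Multiset.card (p.parts.filter (¬ 2 ≤ ·))) 1 := by
      conv_lhs => rw [← Multiset.filter_add_not (2 ≤ ·) p.parts]
      congr 1
      rw [Multiset.eq_replicate_card]
      intro b hb
      rw [Multiset.mem_filter] at hb
      have := p.parts_pos hb.1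
      omega
    have hsum := congrArg Multiset.sum key
    rw [p.parts_sum, Multiset.sum_add, Multiset.sum_replicate, smul_eq_mul, mul_one] at hsum
    obtain ⟨g, hg⟩ := (exists_with_cycleType_iff α (m := p.parts.filter (2 ≤ ·))).2
      ⟨by omega, fun a ha => (Multiset.mem_filter.1 ha).2⟩
    refine ⟨g, Nat.Partition.ext ?_⟩
    rw [parts_partition, ← sum_cycleType, hg]
    conv_rhs => rw [key]
    congr 2
    omega
  · intro g
    rw [centralizer_le_alternating_iff, Finset.mem_inter]
    simp only [Nat.Partition.odds, Nat.Partition.restricted, Nat.Partition.distincts,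
      Finset.mem_filter, Finset.mem_univ, true_and, parts_partition, Multiset.nodup_add,
      Multiset.mem_add, Multiset.mem_replicate, ← sum_cycleType, Nat.not_even_iff_odd,
      ← Multiset.nodup_iff_count_le_one]
    have hd : Disjoint g.cycleType
        (Multiset.replicate (Fintype.card α - g.cycleType.sum) 1) := by
      rw [Multiset.disjoint_left]
      intro a ha hb
      have := two_le_of_mem_cycleType ha
      have := Multiset.eq_of_mem_replicate hb
      omega
    have hr : (Multiset.replicate (Fintype.card α - g.cycleType.sum) 1).Nodup ↔
        Fintype.card α ≤ g.cycleType.sum + 1 := by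
      rw [Multiset.nodup_iff_count_le_one]
      constructor
      · intro h
        have := h 1
        rw [Multiset.count_replicate_self] at this
        omega
      · intro h a
        rw [Multiset.count_replicate]
        split_ifs <;> omega
    rw [hr]
    constructor
    · rintro ⟨h1, h2, h3, -⟩
      exact ⟨fun i hi => h1 i (Or.inl hi), h3, h2⟩
    · rintro ⟨h1, h2, h3⟩
      refine ⟨?_, h3, h2, hd⟩
      rintro i (hi | ⟨-, rfl⟩)
      · exact h1 i hi
      · exact odd_one

/-- The dimension of the space of functions `f : S_n → k` with
`f (σ π σ⁻¹) = sign σ • f π` equals the number of partitions of `n`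
into pairwise distinct odd parts. -/
theorem finrank_signConjInvariants (k : Type*) [Field k] (h2 : (2 : k) ≠ 0)
    (n : ℕ) (hn : 1 ≤ n) :
    Module.finrank k (signConjInvariants k n) =
      (Nat.Partition.odds n ∩ Nat.Partition.distincts n).card := by
  classical
  obtain ⟨P, hs, hc, hT⟩ := exists_partition_map (α := Fin n) n (Fintype.card_fin n)
  set T := Nat.Partition.odds n ∩ Nat.Partition.distincts n with hTdef
  choose g hg using hs
  let L : signConjInvariants k n →ₗ[k] (T → k) :=
    { toFun := fun f p => f.1 (g p)
      map_add' := fun _ _ => rfl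
      map_smul' := fun _ _ => rfl }
  have hinj : Function.Injective L := by
    rw [injective_iff_map_eq_zero]
    rintro ⟨f, hf⟩ h0
    have hf' : ∀ σ π : Equiv.Perm (Fin n),
      f (σ * π * σ⁻¹) = ((Equiv.Perm.sign σ : ℤ) : k) * f π := hf
    ext π
    change f π = 0
    by_cases hp : P π ∈ T
    · have h1 : f (g (P π)) = 0 := congrFun h0 ⟨P π, hp⟩
      obtain ⟨σ, hσ⟩ := isConj_iff.1 ((hc _ _).1 (hg (P π)))
      rw [← hσ, hf', h1, mul_zero]
    · rw [hT, SetLike.not_le_iff_exists] at hp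
      obtain ⟨σ, hσ, hσ'⟩ := hp
      rw [Subgroup.mem_centralizer_singleton_iff] at hσ
      rw [Equiv.Perm.mem_alternatingGroup] at hσ'
      have h1 := hf' σ π
      have h3 : σ * π * σ⁻¹ = π := by
        rw [mul_inv_eq_iff_eq_mul]
        first | exact hσ | exact hσ.symm
      rw [h3, (Int.units_eq_one_or _).resolve_left hσ'] at h1
      have h4 : 2 * f π = 0 := by
        push_cast at h1
        linear_combination h1
      exact (mul_eq_zero.1 h4).resolve_left h2
  have hsurj : Function.Surjective L := by
    intro c
    have hex : ∀ π, ∃ σ, σ * g (P π) * σ⁻¹ = π := fun π =>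
      isConj_iff.1 ((hc _ _).1 (hg (P π)))
    choose s hs using hex
    -- two conjugators from the same representative have the same sign
    have hsign : ∀ p ∈ T, ∀ a b : Equiv.Perm (Fin n),
        a * g p * a⁻¹ = b * g p * b⁻¹ → Equiv.Perm.sign a = Equiv.Perm.sign b := by
      intro p hp a b hab
      have hle := (hT (g p)).1 (by rw [hg]; exact hp)
      have hm : b⁻¹ * a ∈ Subgroup.centralizer {g p} := by
        rw [Subgroup.mem_centralizer_singleton_iff]
        have h5 : b⁻¹ * (a * g p * a⁻¹) * a = b⁻¹ * (b * g p * b⁻¹) * a := by rw [hab]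
        have h6 : b⁻¹ * a * g p = g p * (b⁻¹ * a) := by
          simpa [mul_assoc] using h5
        first | exact h6 | exact h6.symm
      have h7 := Equiv.Perm.mem_alternatingGroup.1 (hle hm)
      rw [map_mul, map_inv, inv_mul_eq_one] at h7
      exact h7.symm
    let f : Equiv.Perm (Fin n) → k := fun π =>
      if h : P π ∈ T then ((Equiv.Perm.sign (s π) : ℤ) : k) * c ⟨P π, h⟩ else 0
    have hf : f ∈ signConjInvariants k n := by
      intro σ π
      have hP : P (σ * π * σ⁻¹) = P π := (hc _ _).2 (isConj_iff.2 ⟨σ⁻¹, by group⟩)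
      by_cases hp : P π ∈ T
      · have hp' : P (σ * π * σ⁻¹) ∈ T := by rw [hP]; exact hp
        have e : (⟨P (σ * π * σ⁻¹), hp'⟩ : T) = ⟨P π, hp⟩ := Subtype.ext hP
        have h8 : Equiv.Perm.sign (s (σ * π * σ⁻¹)) = Equiv.Perm.sign (σ * s π) := by
          apply hsign (P π) hp
          have h9 := hs (σ * π * σ⁻¹)
          rw [hP] at h9
          rw [h9]
          conv_lhs => rw [← hs π]
          group
        simp only [f, dif_pos hp, dif_pos hp', e, h8, map_mul]
        push_cast
        ring
      · have hp' : P (σ * π * σ⁻¹) ∉ T := by rw [hP]; exact hp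
        simp only [f, dif_neg hp, dif_neg hp', mul_zero]
    refine ⟨⟨f, hf⟩, ?_⟩
    ext ⟨p, hp⟩
    change f (g p) = c ⟨p, hp⟩
    have hp' : P (g p) ∈ T := by rw [hg]; exact hp
    have e : (⟨P (g p), hp'⟩ : T) = ⟨p, hp⟩ := Subtype.ext (hg p)
    have h8 : Equiv.Perm.sign (s (g p)) = Equiv.Perm.sign (1 : Equiv.Perm (Fin n)) := by
      apply hsign p hp
      have h9 := hs (g p)
      rw [hg] at h9
      rw [h9]
      simp
    simp only [f, dif_pos hp', e, h8, map_one]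
    simp
  rw [(LinearEquiv.ofBijective L ⟨hinj, hsurj⟩).finrank_eq, Module.finrank_fintype_fun_eq_card,
    Fintype.card_coe]
end

section
/- Let n ≥ 1 and let σ be a permutation in S_n. Every permutation commuting with σ is even (has sign 1) if and only if the partition of n formed by the cycle lengths of σ (with fixed points counted as parts equal to 1) has pairwise distinct parts all of which are odd. -/
/-- Every permutation commuting with `σ ∈ S_n` is even if and only if the partition
of `n` given by the cycle lengths of `σ` (fixed points counted as parts equal to `1`)
has pairwise distinct parts, all of which are odd. -/
theorem commute_sign_eq_one_iff_partition_distinct_odd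
    (n : ℕ) (hn : 1 ≤ n) (σ : Equiv.Perm (Fin n)) :
    (∀ τ : Equiv.Perm (Fin n), τ * σ = σ * τ → Equiv.Perm.sign τ = 1) ↔
      (Equiv.Perm.partition σ).parts.Nodup ∧
        ∀ i ∈ (Equiv.Perm.partition σ).parts, Odd i := by
  have h1 : (∀ τ : Equiv.Perm (Fin n), τ * σ = σ * τ → Equiv.Perm.sign τ = 1) ↔
      Subgroup.centralizer {σ} ≤ alternatingGroup (Fin n) := by
    rw [SetLike.le_def]
    refine forall_congr' fun τ => ?_
    rw [Subgroup.mem_centralizer_singleton_iff, Equiv.Perm.mem_alternatingGroup]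
  rw [h1, Equiv.Perm.centralizer_le_alternating_iff, Equiv.Perm.parts_partition,
    ← Multiset.nodup_iff_count_le_one, Multiset.nodup_add, ← Equiv.Perm.sum_cycleType]
  have h2 : (Multiset.replicate (Fintype.card (Fin n) - σ.cycleType.sum) 1).Nodup ↔
      Fintype.card (Fin n) ≤ σ.cycleType.sum + 1 := by
    rw [Multiset.nodup_iff_count_le_one]
    constructor
    · intro h
      have := h 1
      rw [Multiset.count_replicate_self] at this
      omega
    · intro h i
      rw [Multiset.count_replicate]
      split_ifs <;> omega
  have h3 : Disjoint σ.cycleType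
      (Multiset.replicate (Fintype.card (Fin n) - σ.cycleType.sum) 1) := by
    rw [Multiset.disjoint_left]
    intro a ha hb
    have := Equiv.Perm.two_le_of_mem_cycleType ha
    have := Multiset.eq_of_mem_replicate hb
    omega
  rw [h2]
  constructor
  · rintro ⟨ho, hc, hd⟩
    refine ⟨⟨hd, hc, h3⟩, fun i hi => ?_⟩
    rcases Multiset.mem_add.1 hi with hi | hi
    · exact ho i hi
    · rw [Multiset.eq_of_mem_replicate hi]
      exact odd_one
  · rintro ⟨⟨hd, hc, -⟩, ho⟩
    exact ⟨fun c h => ho c (Multiset.mem_add.2 (Or.inl h)), hc, hd⟩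
end

section
/- Let k be a field of characteristic different from 2 and let n ≥ 1. For i = 1, …, n−1 let C_i be the centralizer in the group algebra k[S_n] of the adjacent transposition t_i = (i, i+1). Then the dimension over k of the quotient vector space k[S_n] / (C_1 + C_2 + ⋯ + C_{n−1}) equals the number of partitions of n into pairwise distinct odd parts. -/
open MonoidAlgebra

/-- The centralizer, inside the group algebra `k[S_n]`, of the adjacent transposition
`t_i = (i, i+1)`, as a `k`-subspace. -/
def adjTranspositionCentralizer (k : Type*) [Field k] (n : ℕ) (i : Fin (n - 1)) :
    Submodule k (MonoidAlgebra k (Equiv.Perm (Fin n))) where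
  carrier := {x |
    MonoidAlgebra.of k (Equiv.Perm (Fin n))
        (Equiv.swap ⟨i.1, by omega⟩ ⟨i.1 + 1, by omega⟩) * x =
      x * MonoidAlgebra.of k (Equiv.Perm (Fin n))
        (Equiv.swap ⟨i.1, by omega⟩ ⟨i.1 + 1, by omega⟩)}
  add_mem' := by
    intro a b ha hb
    simp only [Set.mem_setOf_eq] at ha hb ⊢
    rw [mul_add, add_mul, ha, hb]
  zero_mem' := by simp
  smul_mem' := by
    intro c a ha
    simp only [Set.mem_setOf_eq] at ha ⊢
    rw [mul_smul_comm, smul_mul_assoc, ha]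

namespace CentProof

open Equiv Equiv.Perm

/-- The partition of `n` attached to a permutation of `Fin n`. -/
def part {n : ℕ} (g : Perm (Fin n)) : n.Partition where
  parts := g.partition.parts
  parts_pos := g.partition.parts_pos
  parts_sum := by rw [g.partition.parts_sum, Fintype.card_fin]

theorem isConj_iff_part {n : ℕ} (g h : Perm (Fin n)) : IsConj g h ↔ part g = part h := by
  rw [Equiv.Perm.partition_eq_of_isConj, Nat.Partition.ext_iff, Nat.Partition.ext_iff]
  rfl

theorem part_parts {n : ℕ} (g : Perm (Fin n)) :
    (part g).parts = g.cycleType + Multiset.replicate (n - g.cycleType.sum) 1 := by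
  change g.partition.parts = _
  rw [parts_partition, Fintype.card_fin, sum_cycleType]

theorem part_surj {n : ℕ} (p : n.Partition) : ∃ g : Perm (Fin n), part g = p := by
  have hadd := Multiset.filter_add_not (fun a => 2 ≤ a) p.parts
  have hrep : p.parts.filter (fun a => ¬ 2 ≤ a) =
      Multiset.replicate (p.parts.filter (fun a => ¬ 2 ≤ a)).card 1 := by
    rw [Multiset.eq_replicate]
    refine ⟨rfl, fun b hb => ?_⟩
    rw [Multiset.mem_filter] at hb
    have := p.parts_pos hb.1
    omega
  have hsum := congrArg Multiset.sum hadd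
  rw [hrep, Multiset.sum_add, p.parts_sum, Multiset.sum_replicate, smul_eq_mul, mul_one] at hsum
  obtain ⟨g, hg⟩ := (Equiv.Perm.exists_with_cycleType_iff (Fin n)
    (m := p.parts.filter (fun a => 2 ≤ a))).2
    ⟨by rw [Fintype.card_fin]; omega, fun a ha => (Multiset.mem_filter.1 ha).2⟩
  refine ⟨g, ?_⟩
  rw [Nat.Partition.ext_iff, part_parts, hg]
  conv_rhs => rw [← hadd, hrep]
  congr 2
  omega

theorem good_iff {n : ℕ} (g : Perm (Fin n)) :
    Subgroup.centralizer {g} ≤ alternatingGroup (Fin n) ↔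
      part g ∈ Nat.Partition.odds n ∩ Nat.Partition.distincts n := by
  rw [Equiv.Perm.centralizer_le_alternating_iff, Finset.mem_inter, Nat.Partition.odds,
    Nat.Partition.restricted, Nat.Partition.distincts, Finset.mem_filter, Finset.mem_filter,
    part_parts, Fintype.card_fin]
  simp only [Finset.mem_univ, true_and, Nat.not_even_iff_odd]
  have h1 : (1 : ℕ) ∉ g.cycleType := fun h => absurd (one_lt_of_mem_cycleType h) (by omega)
  constructor
  · rintro ⟨ho, hc, hn⟩
    refine ⟨fun i hi => ?_, ?_⟩
    · rcases Multiset.mem_add.1 hi with hi | hi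
      · exact ho i hi
      · rw [Multiset.eq_of_mem_replicate hi]; exact odd_one
    · rw [Multiset.nodup_iff_count_le_one]
      intro i
      rw [Multiset.count_add, Multiset.count_replicate]
      have := hn i
      split_ifs with h
      · subst h
        rw [Multiset.count_eq_zero_of_notMem h1]
        omega
      · omega
  · rintro ⟨ho, hn⟩
    rw [Multiset.nodup_iff_count_le_one] at hn
    refine ⟨fun c hc => ho c (Multiset.mem_add.2 (Or.inl hc)), ?_, fun i => ?_⟩
    · have := hn 1
      rw [Multiset.count_add, Multiset.count_replicate, if_pos rfl] at this
      omega
    · have := hn i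
      rw [Multiset.count_add] at this
      omega

variable {k : Type*} [Field k]

/-- The sign of a permutation, in `k`. -/
def sg (k : Type*) [Field k] {n : ℕ} (s : Perm (Fin n)) : k := ((sign s : ℤ) : k)

theorem sg_mul {n : ℕ} (s t : Perm (Fin n)) : sg k (s * t) = sg k s * sg k t := by
  simp [sg]

theorem sg_swap {n : ℕ} {a b : Fin n} (h : a ≠ b) : sg k (swap a b) = -1 := by
  simp [sg, sign_swap h]

theorem sg_one {n : ℕ} : sg k (1 : Perm (Fin n)) = 1 := by
  simp [sg]

theorem sg_even {n : ℕ} {s : Perm (Fin n)} (h : s ∈ alternatingGroup (Fin n)) : sg k s = 1 := by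
  rw [mem_alternatingGroup] at h
  simp [sg, h]

theorem sg_odd {n : ℕ} {s : Perm (Fin n)} (h : s ∉ alternatingGroup (Fin n)) : sg k s = -1 := by
  rw [mem_alternatingGroup] at h
  rcases Int.units_eq_one_or (sign s) with hpos | hneg
  · exact absurd hpos h
  · simp [sg, hneg]

/-- `f` is a sign-twisted class function. -/
def Twisted {n : ℕ} (f : Module.Dual k (MonoidAlgebra k (Perm (Fin n)))) : Prop :=
  ∀ s g : Perm (Fin n), f (MonoidAlgebra.of k _ (s * g * s⁻¹)) =
    sg k s * f (MonoidAlgebra.of k _ g)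

theorem vanish_iff (h2 : (2 : k) ≠ 0) {n : ℕ} (i : Fin (n - 1))
    (f : Module.Dual k (MonoidAlgebra k (Perm (Fin n)))) :
    f ∈ (adjTranspositionCentralizer k n i).dualAnnihilator ↔
      ∀ g : Perm (Fin n), f (MonoidAlgebra.of k _
        (swap (⟨i.1, by omega⟩ : Fin n) ⟨i.1 + 1, by omega⟩ * g *
          (swap (⟨i.1, by omega⟩ : Fin n) ⟨i.1 + 1, by omega⟩)⁻¹)) =
        - f (MonoidAlgebra.of k _ g) := by
  rw [Submodule.mem_dualAnnihilator]
  have htt : (swap (⟨i.1, by omega⟩ : Fin n) ⟨i.1 + 1, by omega⟩) *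
    (swap (⟨i.1, by omega⟩ : Fin n) ⟨i.1 + 1, by omega⟩) = 1 := swap_mul_self _ _
  have hmem : ∀ x, x ∈ adjTranspositionCentralizer k n i ↔ MonoidAlgebra.of k (Perm (Fin n))
        (swap ⟨i.1, by omega⟩ ⟨i.1 + 1, by omega⟩) * x =
      x * MonoidAlgebra.of k (Perm (Fin n))
        (swap ⟨i.1, by omega⟩ ⟨i.1 + 1, by omega⟩) := fun x => Iff.rfl
  simp only [hmem]
  generalize (swap (⟨i.1, by omega⟩ : Fin n) ⟨i.1 + 1, by omega⟩) = t at htt ⊢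
  have hinv : t⁻¹ = t := inv_eq_of_mul_eq_one_left htt
  rw [hinv]
  constructor
  · intro h g
    have := h (MonoidAlgebra.of k _ (t * g * t) + MonoidAlgebra.of k _ g) (by
      rw [mul_add, add_mul, ← map_mul, ← map_mul, ← map_mul, ← map_mul, add_comm]
      congr 2
      · rw [mul_assoc, htt, mul_one]
      · rw [← mul_assoc, ← mul_assoc, htt, one_mul])
    rw [map_add] at this
    exact eq_neg_of_add_eq_zero_left this
  · intro h x hx
    have key : ∀ y, f (MonoidAlgebra.of k _ t * y * MonoidAlgebra.of k _ t) = - f y := by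
      intro y
      induction y using MonoidAlgebra.induction_on with
      | of g => rw [← map_mul, ← map_mul, h]
      | add a b ha hb => rw [mul_add, add_mul, map_add, ha, hb, map_add, neg_add]
      | smul r a ha => rw [mul_smul_comm, smul_mul_assoc, map_smul, ha, map_smul, smul_neg]
    have hk := key x
    rw [hx, mul_assoc, ← map_mul, htt, map_one, mul_one] at hk
    have : 2 * f x = 0 := by linear_combination hk
    exact (mul_eq_zero.1 this).resolve_left h2

theorem mem_iff_twisted (h2 : (2 : k) ≠ 0) {n : ℕ} (hn : 1 ≤ n)
    (f : Module.Dual k (MonoidAlgebra k (Perm (Fin n)))) :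
    f ∈ (⨆ i : Fin (n - 1), adjTranspositionCentralizer k n i).dualAnnihilator ↔ Twisted f := by
  rw [Submodule.dualAnnihilator_iSup_eq, Submodule.mem_iInf]
  simp only [vanish_iff h2]
  constructor
  · intro h s
    obtain ⟨m, rfl⟩ : ∃ m, n = m + 1 := ⟨n - 1, by omega⟩
    have hs : s ∈ Submonoid.closure (Set.range fun i : Fin m ↦ swap i.castSucc i.succ) := by
      rw [mclosure_swap_castSucc_succ]; trivial
    induction hs using Submonoid.closure_induction with
    | mem x hx =>
      obtain ⟨i, rfl⟩ := hx
      intro g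
      rw [sg_swap (by simp [Fin.ext_iff]), neg_one_mul]
      exact h i g
    | one => intro g; simp [sg_one]
    | mul x y _ _ hx hy =>
      intro g
      rw [show x * y * g * (x * y)⁻¹ = x * (y * g * y⁻¹) * x⁻¹ by group, hx, hy, sg_mul, mul_assoc]
  · intro h i g
    rw [h, sg_swap (by simp [Fin.ext_iff]), neg_one_mul]

/-- A chosen permutation with given partition. -/
noncomputable def rep {n : ℕ} (p : n.Partition) : Perm (Fin n) := (part_surj p).choose

theorem part_rep {n : ℕ} (p : n.Partition) : part (rep p) = p := (part_surj p).choose_spec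

theorem exists_conj {n : ℕ} (g : Perm (Fin n)) : ∃ s, s * rep (part g) * s⁻¹ = g :=
  isConj_iff.1 ((isConj_iff_part _ _).2 (part_rep _))

/-- A chosen conjugating permutation. -/
noncomputable def cj {n : ℕ} (g : Perm (Fin n)) : Perm (Fin n) := (exists_conj g).choose

theorem cj_spec {n : ℕ} (g : Perm (Fin n)) : cj g * rep (part g) * (cj g)⁻¹ = g :=
  (exists_conj g).choose_spec

/-- Two conjugators to the same element have the same sign. -/
theorem sg_eq {n : ℕ} {r s t : Perm (Fin n)}
    (hr : Subgroup.centralizer {r} ≤ alternatingGroup (Fin n))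
    (h : s * r * s⁻¹ = t * r * t⁻¹) : sg k s = sg k t := by
  have hc : t⁻¹ * s ∈ Subgroup.centralizer {r} := by
    rw [Subgroup.mem_centralizer_singleton_iff]
    have hsr : s * r = t * r * t⁻¹ * s := by rw [← h]; group
    rw [mul_assoc, hsr]; group
  have := sg_mul (k := k) t (t⁻¹ * s)
  rwa [mul_inv_cancel_left, sg_even (hr hc), mul_one] at this

/-- The good partitions. -/
abbrev Good (n : ℕ) : Finset n.Partition := Nat.Partition.odds n ∩ Nat.Partition.distincts n

/-- The evaluation map at representatives. -/
noncomputable def ev (n : ℕ) (W : Submodule k (Module.Dual k (MonoidAlgebra k (Perm (Fin n))))) :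
    W →ₗ[k] (Good n → k) where
  toFun f p := f.1 (MonoidAlgebra.of k _ (rep p.1))
  map_add' _ _ := rfl
  map_smul' _ _ := rfl

theorem twisted_zero (h2 : (2 : k) ≠ 0) {n : ℕ}
    {f : Module.Dual k (MonoidAlgebra k (Perm (Fin n)))}
    (hf : Twisted f) (h : ∀ p ∈ Good n, f (MonoidAlgebra.of k _ (rep p)) = 0) : f = 0 := by
  have key : ∀ g, f (MonoidAlgebra.of k _ g) = 0 := by
    intro g
    by_cases hg : part g ∈ Good n
    · rw [← cj_spec g, hf, h _ hg, mul_zero]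
    · rw [← good_iff, SetLike.not_le_iff_exists] at hg
      obtain ⟨s, hs, hodd⟩ := hg
      rw [Subgroup.mem_centralizer_singleton_iff] at hs
      have := hf s g
      rw [hs, mul_inv_cancel_right, sg_odd hodd] at this
      have : 2 * f (MonoidAlgebra.of k _ g) = 0 := by linear_combination this
      exact (mul_eq_zero.1 this).resolve_left h2
  ext g
  simpa using key g

theorem exists_twisted {n : ℕ} (v : Good n → k) :
    ∃ f : Module.Dual k (MonoidAlgebra k (Perm (Fin n))), Twisted f ∧
      ∀ p : Good n, f (MonoidAlgebra.of k _ (rep p.1)) = v p := by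
  classical
  let w : n.Partition → k := fun p => if h : p ∈ Good n then v ⟨p, h⟩ else 0
  let F : Perm (Fin n) → k := fun g => sg k (cj g) * w (part g)
  obtain ⟨f, hf⟩ : ∃ f : Module.Dual k (MonoidAlgebra k (Perm (Fin n))),
      ∀ g, f (MonoidAlgebra.of k _ g) = F g :=
    ⟨(Finsupp.linearCombination k F).comp (MonoidAlgebra.coeffLinearEquiv k).toLinearMap, by
      intro g; simp⟩
  refine ⟨f, ?_, ?_⟩
  · intro s g
    rw [hf, hf]
    change sg k _ * w _ = sg k s * (sg k _ * w _)
    have hp : part (s * g * s⁻¹) = part g :=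
      (isConj_iff_part _ _).1 (isConj_iff.2 ⟨s, rfl⟩).symm
    have hc := cj_spec (s * g * s⁻¹)
    rw [hp] at hc
    rw [hp, ← mul_assoc, ← sg_mul]
    by_cases hg : part g ∈ Good n
    · congr 1
      refine sg_eq (r := rep (part g)) ((good_iff _).2 (by rwa [part_rep])) ?_
      rw [hc]
      conv_lhs => rw [← cj_spec g]
      group
    · have : w (part g) = 0 := dif_neg hg
      rw [this, mul_zero, mul_zero]
  · rintro ⟨p, hp⟩
    rw [hf]
    change sg k _ * w _ = _
    have h1 : sg k (cj (rep p)) = 1 := by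
      rw [← sg_one (k := k) (n := n)]
      refine sg_eq (r := rep p) ((good_iff _).2 (by rwa [part_rep])) ?_
      have := cj_spec (rep p)
      rw [part_rep] at this
      rw [this]; simp
    rw [h1, one_mul, part_rep]
    exact dif_pos hp

end CentProof

/-- The dimension of `k[S_n]` modulo the sum of the centralizers of the adjacent
transpositions equals the number of partitions of `n` into pairwise distinct odd
parts. -/
theorem finrank_quotient_sum_adjTranspositionCentralizers
    (k : Type*) [Field k] (h2 : (2 : k) ≠ 0) (n : ℕ) (hn : 1 ≤ n) :
    Module.finrank k
        (MonoidAlgebra k (Equiv.Perm (Fin n)) ⧸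
          ⨆ i : Fin (n - 1), adjTranspositionCentralizer k n i) =
      (Nat.Partition.odds n ∩ Nat.Partition.distincts n).card := by
  classical
  rw [← Subspace.dual_finrank_eq, (Submodule.dualQuotEquivDualAnnihilator _).finrank_eq]
  have hb : Function.Bijective (CentProof.ev n
      (⨆ i : Fin (n - 1), adjTranspositionCentralizer k n i).dualAnnihilator) := by
    constructor
    · refine (injective_iff_map_eq_zero _).2 ?_
      rintro ⟨f, hf⟩ h
      refine Subtype.ext (CentProof.twisted_zero h2
        ((CentProof.mem_iff_twisted h2 hn f).1 hf) fun p hp => ?_)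
      exact congrFun h ⟨p, hp⟩
    · intro v
      obtain ⟨f, hf, hv⟩ := CentProof.exists_twisted v
      exact ⟨⟨f, (CentProof.mem_iff_twisted h2 hn f).2 hf⟩, funext hv⟩
  rw [(LinearEquiv.ofBijective _ hb).finrank_eq, Module.finrank_fintype_fun_eq_card,
    Fintype.card_coe]
end

section
/- Let k be a field, let n ≥ 1, and let A be a commutative k-algebra whose dimension over k is strictly greater than 1, such that the n-fold tensor power A^{⊗n} = A ⊗_k ⋯ ⊗_k A has no zero divisors. Let M be a free A^{⊗n}-module and let m_1, …, m_n ∈ M be such that for every a ∈ A one has Σ_{i=1}^n a^{(i)} • m_i = 0, where a^{(i)} = 1 ⊗ ⋯ ⊗ 1 ⊗ a ⊗ 1 ⊗ ⋯ ⊗ 1 ∈ A^{⊗n} has a placed in the i-th tensor factor. Then m_i = 0 for every i = 1, …, n. -/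
open scoped TensorProduct

/-- If `A` is a commutative `k`-algebra of dimension `> 1` whose `n`-fold tensor
power `A^{⊗n}` has no zero divisors, `M` is a free `A^{⊗n}`-module and
`m_1, …, m_n ∈ M` satisfy `Σ_i a^{(i)} • m_i = 0` for every `a ∈ A` (where
`a^{(i)}` is the pure tensor with `a` in the `i`-th slot and `1` elsewhere),
then all `m_i` vanish. -/
theorem eq_zero_of_forall_sum_smul_single_tensor_eq_zero
    (k : Type*) [Field k] (n : ℕ) (hn : 1 ≤ n)
    (A : Type*) [CommRing A] [Algebra k A] (hA : 1 < Module.rank k A)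
    [NoZeroDivisors (⨂[k] (_ : Fin n), A)]
    (M : Type*) [AddCommGroup M] [Module (⨂[k] (_ : Fin n), A) M]
    [Module.Free (⨂[k] (_ : Fin n), A) M]
    (m : Fin n → M)
    (h : ∀ a : A,
      ∑ i : Fin n,
        (PiTensorProduct.tprod k (Function.update (fun _ : Fin n => (1 : A)) i a)) • m i
          = 0) :
    ∀ i, m i = 0 := by
  classical
  intro i₀
  -- an element of `A` that is not a scalar multiple of `1`
  have hx : ∃ a : A, a ∉ Submodule.span k {(1 : A)} := by
    by_contra! hc
    have htop : Submodule.span k {(1 : A)} = ⊤ := by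
      rw [eq_top_iff]; intro a _; exact hc a
    have h1 := rank_span_le (R := k) ({(1 : A)} : Set A)
    rw [htop, rank_top, Cardinal.mk_singleton] at h1
    exact absurd hA (not_lt.mpr h1)
  obtain ⟨a, ha⟩ := hx
  have hA1 : (1 : A) ≠ 0 := by
    intro h0
    apply ha
    rw [← mul_one a, h0, mul_zero]
    exact Submodule.zero_mem _
  obtain ⟨f, hf⟩ : ∃ f : A →ₗ[k] k, f 1 ≠ 0 := by
    by_contra! hc
    exact hA1 ((Module.forall_dual_apply_eq_zero_iff k (1 : A)).mp hc)
  obtain ⟨g, hga, hg⟩ := Submodule.exists_dual_map_eq_bot_of_notMem ha inferInstance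
  have hg1 : g 1 = 0 := by
    have : g 1 ∈ Submodule.map g (Submodule.span k {(1 : A)}) :=
      Submodule.mem_map_of_mem (Submodule.mem_span_singleton_self _)
    rw [hg] at this
    exact (Submodule.mem_bot k).mp this
  set x : Fin n → ⨂[k] (_ : Fin n), A := fun i =>
    PiTensorProduct.singleAlgHom (R := k) (A := fun _ : Fin n => A) i a with hxdef
  have hsing : ∀ (i : Fin n) (b : A),
      PiTensorProduct.tprod k (Function.update (fun _ : Fin n => (1 : A)) i b)
        = PiTensorProduct.singleAlgHom (R := k) (A := fun _ : Fin n => A) i b := by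
    intro i b
    rfl
  have hinj : Function.Injective x := by
    intro i j hij
    by_contra hne
    let F : Fin n → (A →ₗ[k] k) := fun l => if l = i then g else f
    let Φ : (⨂[k] (_ : Fin n), A) →ₗ[k] k :=
      PiTensorProduct.lift ((MultilinearMap.mkPiAlgebra k (Fin n) k).compLinearMap F)
    have hΦ : ∀ v : Fin n → A, Φ (PiTensorProduct.tprod k v) = ∏ l, F l (v l) := by
      intro v
      simp [Φ]
    have e : Φ (x i) = Φ (x j) := by rw [hij]
    simp only [hxdef, ← hsing, hΦ] at e
    have ej : ∏ l, F l (Function.update (fun _ : Fin n => (1 : A)) j a l) = 0 := by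
      apply Finset.prod_eq_zero (Finset.mem_univ i)
      simp [F, Function.update_of_ne hne, hg1]
    rw [ej, Finset.prod_eq_zero_iff] at e
    obtain ⟨l, -, hl⟩ := e
    by_cases hli : l = i
    · subst hli
      simp [F] at hl
      exact hga hl
    · simp [F, hli, Function.update_of_ne hli] at hl
      exact hf hl
  rcases subsingleton_or_nontrivial (⨂[k] (_ : Fin n), A) with hs | hs
  · have := Module.subsingleton (⨂[k] (_ : Fin n), A) M
    exact Subsingleton.elim _ _
  haveI : IsDomain (⨂[k] (_ : Fin n), A) := NoZeroDivisors.to_isDomain _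
  have hdet : (Matrix.vandermonde x).det ≠ 0 := Matrix.det_vandermonde_ne_zero_iff.mpr hinj
  let B := Module.Free.chooseBasis (⨂[k] (_ : Fin n), A) M
  apply B.repr.injective
  ext b
  have hv : Matrix.vecMul (fun i => B.repr (m i) b) (Matrix.vandermonde x) = 0 := by
    ext j
    have hj := congrArg (fun y => B.repr y b) (h (a ^ (j : ℕ)))
    simp only [hsing, map_pow, map_sum, map_smul, map_zero, Finsupp.coe_finsetSum,
      Finset.sum_apply, Finsupp.smul_apply, smul_eq_mul, Finsupp.coe_zero, Pi.zero_apply] at hj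
    simp only [Matrix.vecMul, dotProduct, Matrix.vandermonde_apply, Pi.zero_apply]
    rw [← hj]
    exact Finset.sum_congr rfl fun i _ => mul_comm _ _
  have := congrFun (Matrix.eq_zero_of_vecMul_eq_zero hdet hv) i₀
  simpa using this
end

section
/- Let k be a field, n ≥ 1, and let A be a commutative k-algebra containing two k-linearly independent elements and such that the n-fold tensor power A^{⊗n} has no zero divisors. Let S_n act on A^{⊗n} by permuting the tensor factors. If σ ∈ S_n is not the identity and x ∈ A^{⊗n} satisfies x · (σ · b) = x · b for every b ∈ A^{⊗n}, then x = 0. -/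
open scoped TensorProduct

/-- If `A` is a commutative `k`-algebra containing two linearly independent elements
and whose `n`-fold tensor power `A^{⊗n}` has no zero divisors, and `σ ∈ S_n` is a
nontrivial permutation, then any `x ∈ A^{⊗n}` with `x · (σ · b) = x · b` for all
`b ∈ A^{⊗n}` is zero.  (Here `σ` acts by permuting the tensor factors.) -/
theorem eq_zero_of_mul_perm_eq_mul
    (k : Type*) [Field k] (n : ℕ) (hn : 1 ≤ n)
    (A : Type*) [CommRing A] [Algebra k A]
    (hA : ∃ a b : A, LinearIndependent k ![a, b])
    [NoZeroDivisors (⨂[k] (_ : Fin n), A)]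
    (σ : Equiv.Perm (Fin n)) (hσ : σ ≠ 1)
    (x : ⨂[k] (_ : Fin n), A)
    (hx : ∀ b : ⨂[k] (_ : Fin n), A,
      x * (PiTensorProduct.reindex k (fun _ : Fin n => A) σ b) = x * b) :
    x = 0 := by
  obtain ⟨a, b, hab⟩ := hA
  obtain ⟨i, hi⟩ : ∃ i, σ i ≠ i := by
    by_contra! h
    exact hσ (Equiv.ext h)
  obtain ⟨g, hg⟩ := LinearMap.exists_leftInverse_of_injective
    (Fintype.linearCombination k ![a, b])
    (LinearMap.ker_eq_bot.mpr
      hab.fintypeLinearCombination_injective)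
  have ga : g a = Pi.single 0 1 := by
    have := LinearMap.congr_fun hg (Pi.single 0 1)
    simpa [Fintype.linearCombination_apply] using this
  have gb : g b = Pi.single 1 1 := by
    have := LinearMap.congr_fun hg (Pi.single 1 1)
    simpa [Fintype.linearCombination_apply] using this
  let t : Fin n → A := fun j => if j = i then a else b
  let f : Fin n → (A →ₗ[k] k) := fun j =>
    if j = i then (LinearMap.proj 0).comp g else (LinearMap.proj 1).comp g
  let F : (⨂[k] (_ : Fin n), A) →ₗ[k] k :=
    PiTensorProduct.lift ((MultilinearMap.mkPiAlgebra k (Fin n) k).compLinearMap f)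
  have hF : ∀ u : Fin n → A, F (PiTensorProduct.tprod k u) = ∏ j, f j (u j) := by
    intro u
    simp [F]
  have h1 : F (PiTensorProduct.tprod k t) = 1 := by
    rw [hF]
    apply Finset.prod_eq_one
    intro j _
    by_cases h : j = i <;> simp [f, t, h, ga, gb]
  have h2 : F (PiTensorProduct.reindex k (fun _ : Fin n => A) σ
      (PiTensorProduct.tprod k t)) = 0 := by
    rw [PiTensorProduct.reindex_tprod, hF]
    apply Finset.prod_eq_zero (Finset.mem_univ i)
    have h : σ.symm i ≠ i := fun h => hi (by rw [Equiv.symm_apply_eq] at h; exact h.symm)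
    simp [f, t, h, gb]
  have h3 := hx (PiTensorProduct.tprod k t)
  rw [← sub_eq_zero, ← mul_sub] at h3
  rcases mul_eq_zero.mp h3 with h | h
  · exact h
  · rw [sub_eq_zero] at h
    rw [h, h1] at h2
    exact absurd h2 one_ne_zero
end
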